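/- arXiv:2605.31334 — 3 statements merged into one kernel-verified Lean document; each statement's English description precedes it below -/
import Mathlib

section
/- For all v, w ∈ ℝ⁸, (v⌟w⌟Φ₀) ∧ (v⌟w⌟Φ₀) ∧ Φ₀ = 6·(|v|²·|w|² − ⟨v,w⟩²)·vol₀, where |·| and ⟨·,·⟩ are the standard Euclidean norm and inner product on ℝ⁸ (so that |v∧w|² = |v|²|w|² − ⟨v,w⟩²). -/
open scoped TensorProduct
open Matrix

noncomputable section

/-- `ℝ⁸` with its standard basis. -/
abbrev V : Type := Fin 8 → ℝ

/-- Alternating `k`-forms on `ℝ⁸`. -/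
abbrev Form (k : ℕ) : Type := V [⋀^Fin k]→ₗ[ℝ] ℝ

/-- Standard basis vector `eᵢ` of `ℝ⁸`. -/
def e (i : Fin 8) : V := Pi.single i 1

/-- The elementary 4-form `eⁱ∧eʲ∧eᵏ∧eˡ` (determinant convention). -/
def E4 (i j k l : Fin 8) : Form 4 :=
  (Matrix.detRowAlternating : (Fin 4 → ℝ) [⋀^Fin 4]→ₗ[ℝ] ℝ).compLinearMap
    (LinearMap.funLeft ℝ ℝ ![i, j, k, l])

/-- The Cayley 4-form `Φ₀` on `ℝ⁸` (indices shifted from `1,…,8` to `0,…,7`):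
`Φ₀ = e^{1234}+e^{1256}+e^{1278}+e^{1357}−e^{1368}−e^{1458}−e^{1467}
      +e^{5678}+e^{3478}+e^{3456}+e^{2468}−e^{2457}−e^{2367}−e^{2358}`. -/
def Φ₀ : Form 4 :=
  E4 0 1 2 3 + E4 0 1 4 5 + E4 0 1 6 7 + E4 0 2 4 6 - E4 0 2 5 7 - E4 0 3 4 7 - E4 0 3 5 6
    + E4 4 5 6 7 + E4 2 3 6 7 + E4 2 3 4 5 + E4 1 3 5 7 - E4 1 3 4 6 - E4 1 2 5 6 - E4 1 2 4 7

/-- The standard volume form `e¹∧e²∧⋯∧e⁸` of `ℝ⁸`. -/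
def vol₀ : Form 8 := Matrix.detRowAlternating

/-- The wedge product of alternating forms (shuffle convention, so that
`(e¹∧e²)(e₁,e₂) = 1`). -/
def wedge {k l : ℕ} (α : Form k) (β : Form l) : Form (k + l) :=
  AlternatingMap.domDomCongr finSumFinEquiv
    ((LinearMap.mul' ℝ ℝ).compAlternatingMap (AlternatingMap.domCoprod α β))

/-- The double contraction `v ⌟ w ⌟ Φ`, i.e. the alternating 2-form
`(x, y) ↦ Φ (w, v, x, y)`. -/
def contr (v w : V) (Φ : Form 4) : Form 2 :=
  AlternatingMap.curryLeft (AlternatingMap.curryLeft Φ w) v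

/-- The inner product on alternating `k`-forms on `ℝ⁸` making the forms
`e^{i₁}∧⋯∧e^{i_k}` with `i₁<⋯<i_k` an orthonormal basis. -/
def formInner {k : ℕ} (α β : Form k) : ℝ :=
  ∑ s : Finset (Fin 8),
    if h : s.card = k then
      α (fun a => e ((s.orderIsoOfFin h a : Fin 8))) *
        β (fun a => e ((s.orderIsoOfFin h a : Fin 8)))
    else 0

/-- A 4-form `Ψ` on `ℝ⁸` is admissible (a `Spin(7)`-form) if `Ψ = g*Φ₀` for some
`g ∈ GL(8,ℝ)`, where `(g*Φ₀)(x,y,z,w) = Φ₀(gx,gy,gz,gw)`. -/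
def Admissible (Ψ : Form 4) : Prop :=
  ∃ g : V →ₗ[ℝ] V, Function.Bijective g ∧ Ψ = Φ₀.compLinearMap g

/-- The wedge product as a signed sum over all permutations of the arguments. -/
theorem factorial_smul_wedge_apply {k l : ℕ} (α : Form k) (β : Form l) (x : Fin (k + l) → V) :
    ((k.factorial * l.factorial : ℕ) : ℝ) * wedge α β x =
      ∑ σ : Equiv.Perm (Fin (k + l)), ((Equiv.Perm.sign σ : ℤ) : ℝ) *
        (α (fun i => x (σ (Fin.castAdd l i))) * β (fun i => x (σ (Fin.natAdd k i)))) := by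
  have h := congrArg
    (fun f => LinearMap.mul' ℝ ℝ (f (fun i => x (finSumFinEquiv i))))
    (MultilinearMap.domCoprod_alternization_eq α β)
  simp only [Fintype.card_fin, AlternatingMap.smul_apply, map_nsmul] at h
  rw [nsmul_eq_mul] at h
  refine h.symm.trans ?_
  rw [MultilinearMap.alternatization_apply, map_sum]
  refine Fintype.sum_equiv (finSumFinEquiv.permCongr) _ _ fun σ => ?_
  rw [Equiv.Perm.sign_permCongr]
  rcases Int.units_eq_one_or (Equiv.Perm.sign σ) with hs | hs <;>
    simp [hs, MultilinearMap.domCoprod_apply, Equiv.permCongr_apply]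

/-- The wedge product of two 2-forms. -/
theorem wedge_two_two_apply (α β : Form 2) (a b c d : V) :
    wedge α β ![a, b, c, d] =
      α ![a, b] * β ![c, d] - α ![a, c] * β ![b, d] + α ![a, d] * β ![b, c]
        + α ![b, c] * β ![a, d] - α ![b, d] * β ![a, c] + α ![c, d] * β ![a, b] := by
  have swap : ∀ (γ : Form 2) (x y : V), γ ![x, y] = -γ ![y, x] := fun γ x y => by
    rw [← γ.map_swap ![y, x] (show (0 : Fin 2) ≠ 1 by decide)]
    congr 1
    ext i
    fin_cases i <;> rfl
  have eta : ∀ (γ : Form 2) (u : Fin 2 → V), γ u = γ ![u 0, u 1] := fun γ u => by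
    congr 1
    ext i
    fin_cases i <;> rfl
  have h : 4 * wedge α β ![a, b, c, d] = ∑ σ : Equiv.Perm (Fin 4),
      ((Equiv.Perm.sign σ : ℤ) : ℝ) *
        (α ![![a, b, c, d] (σ 0), ![a, b, c, d] (σ 1)] *
          β ![![a, b, c, d] (σ 2), ![a, b, c, d] (σ 3)]) := by
    have h := factorial_smul_wedge_apply α β ![a, b, c, d]
    rw [show ((Nat.factorial 2 * Nat.factorial 2 : ℕ) : ℝ) = 4 by norm_num [Nat.factorial]] at h
    refine h.trans (Finset.sum_congr rfl fun σ _ => ?_)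
    rw [eta α, eta β]
    rfl
  have h₁ : ∀ (p : Fin 4) (τ : Equiv.Perm (Fin 3)),
      Equiv.Perm.decomposeFin.symm (p, τ) 2 = Equiv.swap 0 p (τ 1).succ :=
    fun p τ => Equiv.Perm.decomposeFin_symm_apply_succ τ p 1
  have h₂ : ∀ (p : Fin 4) (τ : Equiv.Perm (Fin 3)),
      Equiv.Perm.decomposeFin.symm (p, τ) 3 = Equiv.swap 0 p (τ 2).succ :=
    fun p τ => Equiv.Perm.decomposeFin_symm_apply_succ τ p 2
  have h₃ : ∀ (p : Fin 3) (τ : Equiv.Perm (Fin 2)),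
      Equiv.Perm.decomposeFin.symm (p, τ) 2 = Equiv.swap 0 p (τ 1).succ :=
    fun p τ => Equiv.Perm.decomposeFin_symm_apply_succ τ p 1
  simp [Finset.univ_perm_fin_succ, ← Finset.univ_product_univ, Finset.sum_map,
    Finset.sum_product, Fin.sum_univ_succ, h₁, h₂, h₃, Equiv.swap_apply_def] at h
  rw [swap α b a, swap α c a, swap α d a, swap α c b, swap α d b, swap α d c,
    swap β b a, swap β c a, swap β d a, swap β c b, swap β d b, swap β d c] at h
  linarith

/-- If `β` vanishes as soon as one of its arguments is among the `x i`, only the identity shuffle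
contributes to `α ∧ β`. -/
theorem wedge_append_eq_mul {k l : ℕ} (α : Form k) (β : Form l) (x : Fin k → V) (y : Fin l → V)
    (hβ : ∀ (u : Fin l → V) (i : Fin l) (j : Fin k), u i = x j → β u = 0) :
    wedge α β (Fin.append x y) = α x * β y := by
  have key : ∀ τ : Equiv.Perm.ModSumCongr (Fin k) (Fin l), τ ≠ Quotient.mk'' 1 →
      LinearMap.mul' ℝ ℝ (AlternatingMap.domCoprod.summand α β τ (Sum.elim x y)) = 0 := by
    intro τ
    induction τ using Quotient.inductionOn' with
    | h σ =>
    intro hσ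
    have hσ' : σ ∉ (Equiv.Perm.sumCongrHom (Fin k) (Fin l)).range := by
      contrapose! hσ
      refine (Quotient.sound' ?_).symm
      rw [QuotientGroup.leftRel_apply]
      simpa using hσ
    have hmaps := mt Equiv.Perm.mem_sumCongrHom_range_of_perm_mapsTo_inl hσ'
    rw [Equiv.Perm.perm_mapsTo_inl_iff_mapsTo_inr] at hmaps
    simp only [Set.MapsTo, Set.mem_range, not_forall] at hmaps
    obtain ⟨_, ⟨i, rfl⟩, hi⟩ := hmaps
    obtain ⟨j, hj⟩ : ∃ j, σ (Sum.inr i) = Sum.inl j := by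
      rcases h : σ (Sum.inr i) with j | j
      · exact ⟨j, rfl⟩
      · exact absurd ⟨j, h.symm⟩ hi
    rw [AlternatingMap.domCoprod.summand_mk'']
    have hzero := hβ (fun a => Sum.elim x y (σ (Sum.inr a))) i j (by simp [hj])
    simp [MultilinearMap.domCoprod_apply, hzero]
  have happ : (fun i => Fin.append x y (finSumFinEquiv i)) = Sum.elim x y := by
    ext (i | i) <;> simp
  change LinearMap.mul' ℝ ℝ (AlternatingMap.domCoprod α β
    (fun i => Fin.append x y (finSumFinEquiv i))) = _
  rw [happ, AlternatingMap.domCoprod_apply, _root_.sum_apply, map_sum]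
  refine (Finset.sum_eq_single_of_mem (Quotient.mk'' 1) (Finset.mem_univ _)
    fun τ _ hτ => key τ hτ).trans ?_
  rw [AlternatingMap.domCoprod.summand_mk'']
  simp [MultilinearMap.domCoprod_apply]

theorem wedge_add_apply {k l : ℕ} (α : Form k) (β γ : Form l) (x : Fin (k + l) → V) :
    wedge α (β + γ) x = wedge α β x + wedge α γ x := by
  simp [wedge, ← AlternatingMap.domCoprod'_apply, TensorProduct.tmul_add]

theorem wedge_sub_apply {k l : ℕ} (α : Form k) (β γ : Form l) (x : Fin (k + l) → V) :
    wedge α (β - γ) x = wedge α β x - wedge α γ x := by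
  simp [wedge, ← AlternatingMap.domCoprod'_apply, TensorProduct.tmul_sub]

/-- Wedging with an elementary 4-form extracts the complementary coefficient. -/
theorem wedge_E4_apply_e (α : Form 4) (ρ : Equiv.Perm (Fin 8)) :
    wedge α (E4 (ρ 4) (ρ 5) (ρ 6) (ρ 7)) e =
      ((Equiv.Perm.sign ρ : ℤ) : ℝ) * α ![e (ρ 0), e (ρ 1), e (ρ 2), e (ρ 3)] := by
  set β := E4 (ρ 4) (ρ 5) (ρ 6) (ρ 7) with hβ
  have hρ : (fun i => e (ρ i)) = Fin.append ![e (ρ 0), e (ρ 1), e (ρ 2), e (ρ 3)]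
      ![e (ρ 4), e (ρ 5), e (ρ 6), e (ρ 7)] := by
    funext i
    fin_cases i <;> rfl
  have hβ0 : ∀ (u : Fin 4 → V) (i j : Fin 4),
      u i = ![e (ρ 0), e (ρ 1), e (ρ 2), e (ρ 3)] j → β u = 0 := by
    intro u i j hu
    refine Matrix.det_eq_zero_of_row_eq_zero i fun m => ?_
    change u i (![ρ 4, ρ 5, ρ 6, ρ 7] m) = 0
    rw [hu]
    fin_cases j <;> fin_cases m <;> simp [e]
  have hβ1 : β ![e (ρ 4), e (ρ 5), e (ρ 6), e (ρ 7)] = 1 := by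
    refine Eq.trans (congrArg (Matrix.det (n := Fin 4) (R := ℝ)) ?_) Matrix.det_one
    ext i j
    change ![e (ρ 4), e (ρ 5), e (ρ 6), e (ρ 7)] i (![ρ 4, ρ 5, ρ 6, ρ 7] j) = _
    fin_cases i <;> fin_cases j <;> simp [e]
  have h := wedge_append_eq_mul α β _ ![e (ρ 4), e (ρ 5), e (ρ 6), e (ρ 7)] hβ0
  rw [hβ1, mul_one] at h
  have hperm : ∀ F : Form 8, F (fun i => e (ρ i)) = Equiv.Perm.sign ρ • F e :=
    fun F => F.map_perm e ρ
  rw [← h, ← congrArg (wedge α β) hρ, hperm (wedge α β)]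
  rcases Int.units_eq_one_or (Equiv.Perm.sign ρ) with hs | hs <;> simp [hs]

/-- `α ∧ Φ₀` in terms of the components of `α` (`Φ₀` is self-dual). -/
theorem wedge_Φ₀_apply_e (α : Form 4) :
    wedge α Φ₀ e =
      α ![e 4, e 5, e 6, e 7] + α ![e 2, e 3, e 6, e 7] + α ![e 2, e 3, e 4, e 5]
        + α ![e 1, e 3, e 5, e 7] - α ![e 1, e 3, e 4, e 6] - α ![e 1, e 2, e 5, e 6]
        - α ![e 1, e 2, e 4, e 7] + α ![e 0, e 1, e 2, e 3] + α ![e 0, e 1, e 4, e 5]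
        + α ![e 0, e 1, e 6, e 7] + α ![e 0, e 2, e 4, e 6] - α ![e 0, e 2, e 5, e 7]
        - α ![e 0, e 3, e 4, e 7] - α ![e 0, e 3, e 5, e 6] := by
  have key : ∀ f g : Fin 8 → Fin 8, ∀ (h₁ : Function.LeftInverse g f)
      (h₂ : Function.RightInverse g f), Equiv.Perm.sign (⟨f, g, h₁, h₂⟩ : Equiv.Perm (Fin 8)) = 1 →
      wedge α (E4 (f 4) (f 5) (f 6) (f 7)) e = α ![e (f 0), e (f 1), e (f 2), e (f 3)] := by
    intro f g h₁ h₂ hs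
    simpa [hs] using wedge_E4_apply_e α ⟨f, g, h₁, h₂⟩
  have h0123 : wedge α (E4 0 1 2 3) e = α ![e 4, e 5, e 6, e 7] := by
    simpa using key ![4, 5, 6, 7, 0, 1, 2, 3]
      ![4, 5, 6, 7, 0, 1, 2, 3] (by decide) (by decide) (by decide +kernel)
  have h0145 : wedge α (E4 0 1 4 5) e = α ![e 2, e 3, e 6, e 7] := by
    simpa using key ![2, 3, 6, 7, 0, 1, 4, 5]
      ![4, 5, 0, 1, 6, 7, 2, 3] (by decide) (by decide) (by decide +kernel)
  have h0167 : wedge α (E4 0 1 6 7) e = α ![e 2, e 3, e 4, e 5] := by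
    simpa using key ![2, 3, 4, 5, 0, 1, 6, 7]
      ![4, 5, 0, 1, 2, 3, 6, 7] (by decide) (by decide) (by decide +kernel)
  have h0246 : wedge α (E4 0 2 4 6) e = α ![e 1, e 3, e 5, e 7] := by
    simpa using key ![1, 3, 5, 7, 0, 2, 4, 6]
      ![4, 0, 5, 1, 6, 2, 7, 3] (by decide) (by decide) (by decide +kernel)
  have h0257 : wedge α (E4 0 2 5 7) e = α ![e 1, e 3, e 4, e 6] := by
    simpa using key ![1, 3, 4, 6, 0, 2, 5, 7]
      ![4, 0, 5, 1, 2, 6, 3, 7] (by decide) (by decide) (by decide +kernel)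
  have h0347 : wedge α (E4 0 3 4 7) e = α ![e 1, e 2, e 5, e 6] := by
    simpa using key ![1, 2, 5, 6, 0, 3, 4, 7]
      ![4, 0, 1, 5, 6, 2, 3, 7] (by decide) (by decide) (by decide +kernel)
  have h0356 : wedge α (E4 0 3 5 6) e = α ![e 1, e 2, e 4, e 7] := by
    simpa using key ![1, 2, 4, 7, 0, 3, 5, 6]
      ![4, 0, 1, 5, 2, 6, 7, 3] (by decide) (by decide) (by decide +kernel)
  have h4567 : wedge α (E4 4 5 6 7) e = α ![e 0, e 1, e 2, e 3] := by
    simpa using key ![0, 1, 2, 3, 4, 5, 6, 7]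
      ![0, 1, 2, 3, 4, 5, 6, 7] (by decide) (by decide) (by decide +kernel)
  have h2367 : wedge α (E4 2 3 6 7) e = α ![e 0, e 1, e 4, e 5] := by
    simpa using key ![0, 1, 4, 5, 2, 3, 6, 7]
      ![0, 1, 4, 5, 2, 3, 6, 7] (by decide) (by decide) (by decide +kernel)
  have h2345 : wedge α (E4 2 3 4 5) e = α ![e 0, e 1, e 6, e 7] := by
    simpa using key ![0, 1, 6, 7, 2, 3, 4, 5]
      ![0, 1, 4, 5, 6, 7, 2, 3] (by decide) (by decide) (by decide +kernel)
  have h1357 : wedge α (E4 1 3 5 7) e = α ![e 0, e 2, e 4, e 6] := by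
    simpa using key ![0, 2, 4, 6, 1, 3, 5, 7]
      ![0, 4, 1, 5, 2, 6, 3, 7] (by decide) (by decide) (by decide +kernel)
  have h1346 : wedge α (E4 1 3 4 6) e = α ![e 0, e 2, e 5, e 7] := by
    simpa using key ![0, 2, 5, 7, 1, 3, 4, 6]
      ![0, 4, 1, 5, 6, 2, 7, 3] (by decide) (by decide) (by decide +kernel)
  have h1256 : wedge α (E4 1 2 5 6) e = α ![e 0, e 3, e 4, e 7] := by
    simpa using key ![0, 3, 4, 7, 1, 2, 5, 6]
      ![0, 4, 5, 1, 2, 6, 7, 3] (by decide) (by decide) (by decide +kernel)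
  have h1247 : wedge α (E4 1 2 4 7) e = α ![e 0, e 3, e 5, e 6] := by
    simpa using key ![0, 3, 5, 6, 1, 2, 4, 7]
      ![0, 4, 5, 1, 6, 2, 3, 7] (by decide) (by decide) (by decide +kernel)
  simp only [Φ₀, wedge_add_apply, wedge_sub_apply, h0123, h0145, h0167, h0246, h0257, h0347,
    h0356, h4567, h2367, h2345, h1357, h1346, h1256, h1247]

/-- Laplace expansion of an elementary 4-form along its first two arguments. -/
theorem E4_apply (i j k l : Fin 8) (w v x y : V) :
    E4 i j k l ![w, v, x, y] =
      (w i * v j - w j * v i) * (x k * y l - x l * y k)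
      - (w i * v k - w k * v i) * (x j * y l - x l * y j)
      + (w i * v l - w l * v i) * (x j * y k - x k * y j)
      + (w j * v k - w k * v j) * (x i * y l - x l * y i)
      - (w j * v l - w l * v j) * (x i * y k - x k * y i)
      + (w k * v l - w l * v k) * (x i * y j - x j * y i) := by
  change Matrix.det (Matrix.of fun a b : Fin 4 => ![w, v, x, y] a (![i, j, k, l] b)) = _
  simp [Matrix.det_succ_row_zero, Fin.sum_univ_succ, Fin.succAbove, Matrix.submatrix]
  ring

theorem contr_apply (v w x y : V) (Φ : Form 4) : contr v w Φ ![x, y] = Φ ![w, v, x, y] := rfl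

/-- An 8-form on `ℝ⁸` is determined by its value on the standard basis. -/
theorem eq_smul_vol₀ {f : Form 8} {c : ℝ} (hc : f e = c) : f = c • vol₀ := by
  have hb : (Pi.basisFun ℝ (Fin 8) : Fin 8 → V) = e := funext fun i => Pi.basisFun_apply ℝ _ i
  have h := f.eq_smul_basis_det (Pi.basisFun ℝ (Fin 8))
  rwa [Pi.basisFun_det, hb, hc] at h

theorem wedge_contr_contr_Φ₀_apply_e (v w : V) :
    wedge (wedge (contr v w Φ₀) (contr v w Φ₀)) Φ₀ e =
      6 * ((∑ i, v i * v i) * (∑ i, w i * w i) - (∑ i, v i * w i) ^ 2) := by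
  have h := wedge_Φ₀_apply_e (wedge (contr v w Φ₀) (contr v w Φ₀))
  simp only [wedge_two_two_apply] at h
  rw [h]
  clear h
  simp only [contr_apply, Φ₀, AlternatingMap.add_apply, AlternatingMap.sub_apply, E4_apply]
  simp only [e, Pi.single_apply]
  simp only [Fin.isValue, Fin.reduceEq, if_true, if_false, mul_one, mul_zero, sub_zero, zero_sub,
    add_zero, zero_add, sub_self]
  simp only [Fin.sum_univ_eight]
  ring

/-- **Positivity identity for the Cayley form:** for all `v, w ∈ ℝ⁸`,
`(v⌟w⌟Φ₀) ∧ (v⌟w⌟Φ₀) ∧ Φ₀ = 6·(|v|²|w|² − ⟨v,w⟩²)·vol₀`, where `|·|`, `⟨·,·⟩` are the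
standard Euclidean norm and inner product on `ℝ⁸`. -/
theorem cayley_positivity (v w : V) :
    wedge (wedge (contr v w Φ₀) (contr v w Φ₀)) Φ₀ =
      (6 * ((∑ i, v i * v i) * (∑ i, w i * w i) - (∑ i, v i * w i) ^ 2)) • vol₀ := by
  exact eq_smul_vol₀ (wedge_contr_contr_Φ₀_apply_e v w)

end
end

section
/- If g ∈ GL(8,ℝ) satisfies Φ₀(g x, g y, g z, g w) = Φ₀(x, y, z, w) for all x, y, z, w ∈ ℝ⁸, then g is orthogonal (gᵀ g = I) and det g = 1. In other words, the stabilizer Spin(7) of the Cayley form Φ₀ in GL(8,ℝ) is contained in SO(8). -/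
open scoped TensorProduct
open Matrix

noncomputable section

open scoped Kronecker

/-- The value of `eᵃ` at `eᵢ`. -/
def minor₁ (i a : Fin 8) : ℤ := if i = a then 1 else 0

/-- The value of `eᵃ∧eᵇ` at `(eᵢ, eⱼ)`. -/
def minor₂ (i j a b : Fin 8) : ℤ :=
  (if i = a then minor₁ j b else 0) - (if i = b then minor₁ j a else 0)

/-- The value of `eᵃ∧eᵇ∧eᶜ` at `(eᵢ, eⱼ, eₖ)`. -/
def minor₃ (i j k a b c : Fin 8) : ℤ :=
  (if i = a then minor₂ j k b c else 0) - (if i = b then minor₂ j k a c else 0)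
    + (if i = c then minor₂ j k a b else 0)

/-- The value of `eᵃ∧eᵇ∧eᶜ∧eᵈ` at `(eᵢ, eⱼ, eₖ, eₗ)`. -/
def minor₄ (i j k l a b c d : Fin 8) : ℤ :=
  (if i = a then minor₃ j k l b c d else 0) - (if i = b then minor₃ j k l a c d else 0)
    + (if i = c then minor₃ j k l a b d else 0) - (if i = d then minor₃ j k l a b c else 0)

/-- The coefficients of `Φ₀` in the standard basis. -/
def cayleyCoeff (i j k l : Fin 8) : ℤ :=
  minor₄ i j k l 0 1 2 3 + minor₄ i j k l 0 1 4 5 + minor₄ i j k l 0 1 6 7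
    + minor₄ i j k l 0 2 4 6 - minor₄ i j k l 0 2 5 7 - minor₄ i j k l 0 3 4 7
    - minor₄ i j k l 0 3 5 6 + minor₄ i j k l 4 5 6 7 + minor₄ i j k l 2 3 6 7
    + minor₄ i j k l 2 3 4 5 + minor₄ i j k l 1 3 5 7 - minor₄ i j k l 1 3 4 6
    - minor₄ i j k l 1 2 5 6 - minor₄ i j k l 1 2 4 7

theorem e_apply (i a : Fin 8) : e i a = (minor₁ i a : ℝ) := by
  simp [e, minor₁, Pi.single_apply, eq_comm]

theorem ite_eq_minor₁_mul (i a : Fin 8) (x : ℤ) : (if i = a then x else 0) = minor₁ i a * x := by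
  simp [minor₁]

theorem det_fin_four_eq (M : Matrix (Fin 4) (Fin 4) ℝ) :
    M.det = M 0 0 * (M 1 1 * (M 2 2 * M 3 3 - M 2 3 * M 3 2)
        - M 1 2 * (M 2 1 * M 3 3 - M 2 3 * M 3 1) + M 1 3 * (M 2 1 * M 3 2 - M 2 2 * M 3 1))
      - M 0 1 * (M 1 0 * (M 2 2 * M 3 3 - M 2 3 * M 3 2)
        - M 1 2 * (M 2 0 * M 3 3 - M 2 3 * M 3 0) + M 1 3 * (M 2 0 * M 3 2 - M 2 2 * M 3 0))
      + M 0 2 * (M 1 0 * (M 2 1 * M 3 3 - M 2 3 * M 3 1)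
        - M 1 1 * (M 2 0 * M 3 3 - M 2 3 * M 3 0) + M 1 3 * (M 2 0 * M 3 1 - M 2 1 * M 3 0))
      - M 0 3 * (M 1 0 * (M 2 1 * M 3 2 - M 2 2 * M 3 1)
        - M 1 1 * (M 2 0 * M 3 2 - M 2 2 * M 3 0) + M 1 2 * (M 2 0 * M 3 1 - M 2 1 * M 3 0)) := by
  rw [Matrix.det_succ_row_zero, Fin.sum_univ_four]
  simp only [Matrix.det_fin_three, Matrix.submatrix_apply]
  simp [Fin.succAbove]
  ring

theorem E4_basis (i j k l a b c d : Fin 8) :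
    E4 a b c d ![e i, e j, e k, e l] = (minor₄ i j k l a b c d : ℝ) := by
  have h : E4 a b c d ![e i, e j, e k, e l] =
      Matrix.det (Matrix.of fun r s : Fin 4 =>
        (![e i, e j, e k, e l] : Fin 4 → V) r (![a, b, c, d] s)) := rfl
  rw [h, det_fin_four_eq]
  simp only [minor₄, minor₃, minor₂, ite_eq_minor₁_mul]
  push_cast
  simp only [← e_apply]
  rfl

theorem Φ₀_basis (i j k l : Fin 8) :
    Φ₀ ![e i, e j, e k, e l] = (cayleyCoeff i j k l : ℝ) := by
  simp only [Φ₀, AlternatingMap.add_apply, AlternatingMap.sub_apply, E4_basis, cayleyCoeff]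
  push_cast
  rfl

/-- Bit `8 * j + k` of entry `i` records whether `Φ₀` has a nonzero coefficient whose first three
indices are `i`, `j`, `k`. -/
def cayleySupport : Fin 8 → ℕ :=
  ![9132982212281170944, 9060642039443030268, 8915961693750753786, 8626600998404879862,
    8047878661932314094, 6890226847579889118, 4539804001440087486, 17837855883361662]

/-- Bit `8 * j + k` of entry `i` records whether `Φ₀` has a negative coefficient whose first three
indices are `i`, `j`, `k`. -/
def cayleyNegative : Fin 8 → ℕ :=
  ![5483924771100076032, 2705618705000693844, 8082012217559531928, 1634953050111173826,
    4838706585559698792, 1838313370638914574, 3026450324456092068, 5988130931562546]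

/-- The coefficients of `Φ₀`, read off from bit tables of their supports and signs: the last index
of a nonzero coefficient is the bitwise exclusive or of the first three. -/
def cayleyTable (i j k l : Fin 8) : ℤ :=
  if l = i ^^^ j ^^^ k ∧ Nat.testBit (cayleySupport i) (8 * j + k) then
    if Nat.testBit (cayleyNegative i) (8 * j + k) then -1 else 1
  else 0

theorem cayleyCoeff_eq_cayleyTable :
    ∀ i j k l : Fin 8, cayleyCoeff i j k l = cayleyTable i j k l := by
  decide +kernel

theorem cayleyTable_contract (i j m n : Fin 8) :
    ∑ k, cayleyTable i j k (i ^^^ j ^^^ k) * cayleyTable k (i ^^^ j ^^^ k) m n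
      = 6 * ((if i = m ∧ j = n then 1 else 0) - (if i = n ∧ j = m then 1 else 0))
        + 4 * cayleyTable i j m n := by
  simp only [Fin.sum_univ_eight]
  revert i j m n
  decide +kernel

theorem cayleyCoeff_contract (i j m n : Fin 8) :
    ∑ k, ∑ l, cayleyCoeff i j k l * cayleyCoeff k l m n
      = 6 * ((if i = m ∧ j = n then 1 else 0) - (if i = n ∧ j = m then 1 else 0))
        + 4 * cayleyCoeff i j m n := by
  simp only [cayleyCoeff_eq_cayleyTable]
  rw [← cayleyTable_contract]
  refine Finset.sum_congr rfl fun k _ => Finset.sum_eq_single _ (fun l _ hl => ?_) (by simp)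
  simp [cayleyTable, hl]

/-- The index tuples of the fourteen elementary forms in `Φ₀`. -/
def cayleyIndex : Fin 14 → Fin 4 → Fin 8 :=
  ![![0, 1, 2, 3], ![0, 1, 4, 5], ![0, 1, 6, 7], ![0, 2, 4, 6], ![0, 2, 5, 7], ![0, 3, 4, 7],
    ![0, 3, 5, 6], ![4, 5, 6, 7], ![2, 3, 6, 7], ![2, 3, 4, 5], ![1, 3, 5, 7], ![1, 3, 4, 6],
    ![1, 2, 5, 6], ![1, 2, 4, 7]]

/-- The signs of the fourteen elementary forms in `Φ₀`. -/
def cayleySign : Fin 14 → ℤ := ![1, 1, 1, 1, -1, -1, -1, 1, 1, 1, 1, -1, -1, -1]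

/-- The product of four coordinate functions, as a multilinear form. -/
def coordForm (s : Fin 4 → Fin 8) : MultilinearMap ℝ (fun _ : Fin 4 => V) ℝ :=
  (MultilinearMap.mkPiAlgebra ℝ (Fin 4) ℝ).compLinearMap fun r => LinearMap.proj (s r)

theorem Φ₀_eq_sum :
    Φ₀ = ∑ t, (cayleySign t : ℝ) • MultilinearMap.alternatization (coordForm (cayleyIndex t)) := by
  have h : ∀ a b c d, E4 a b c d = MultilinearMap.alternatization (coordForm ![a, b, c, d]) := by
    intro a b c d
    ext v
    simp only [E4, coordForm, AlternatingMap.compLinearMap_apply,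
      MultilinearMap.alternatization_apply, Matrix.detRowAlternating]
    rfl
  simp [Φ₀, h, Fin.sum_univ_succ, cayleySign, cayleyIndex]
  module

theorem wedge_alternatization_coordForm (s t : Fin 4 → Fin 8) (v : Fin 8 → V) :
    wedge (MultilinearMap.alternatization (coordForm s))
      (MultilinearMap.alternatization (coordForm t)) v
      = (Matrix.of fun p q : Fin 8 => v p ((Fin.append s t : Fin 8 → Fin 8) q)).det := by
  rw [wedge, ← MultilinearMap.domCoprod_alternization,
    ← LinearMap.compMultilinearMap_alternatization, AlternatingMap.domDomCongr_apply,
    MultilinearMap.alternatization_apply,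
    ← Matrix.det_submatrix_equiv_self (finSumFinEquiv (m := 4) (n := 4)), Matrix.det_apply]
  refine Finset.sum_congr rfl fun σ _ => ?_
  have hl (a : Fin 4) : (Fin.append s t : Fin 8 → Fin 8) (finSumFinEquiv (Sum.inl a)) = s a :=
    Fin.append_left s t a
  have hr (a : Fin 4) : (Fin.append s t : Fin 8 → Fin 8) (finSumFinEquiv (Sum.inr a)) = t a :=
    Fin.append_right s t a
  simp only [Matrix.submatrix_apply, Matrix.of_apply, Fintype.prod_sum_type, hl, hr]
  rfl

theorem wedge_sum_smul {ι : Type*} [Fintype ι] {k : ℕ} (c : ι → ℝ) (α : ι → Form k)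
    (v : Fin (k + k) → V) :
    wedge (∑ s, c s • α s) (∑ t, c t • α t) v = ∑ s, ∑ t, c s * c t * wedge (α s) (α t) v := by
  let L : Form k ⊗[ℝ] Form k →ₗ[ℝ] ℝ :=
    { toFun := fun x => LinearMap.mul' ℝ ℝ (AlternatingMap.domCoprod' x (v ∘ finSumFinEquiv))
      map_add' := fun x y => by rw [map_add, AlternatingMap.add_apply, map_add]
      map_smul' := fun r x => by
        rw [map_smul, AlternatingMap.smul_apply, map_smul, RingHom.id_apply] }
  have hL (a b : Form k) : wedge a b v = L (a ⊗ₜ b) := rfl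
  simp only [hL, TensorProduct.sum_tmul, TensorProduct.tmul_sum, ← TensorProduct.smul_tmul',
    TensorProduct.tmul_smul, map_sum, map_smul, smul_eq_mul, Finset.mul_sum]
  rw [Finset.sum_comm]
  exact Finset.sum_congr rfl fun s _ => Finset.sum_congr rfl fun t _ => by ring

/-- The sign of `f` if it is a permutation, and zero otherwise. -/
def inversionSign (f : Fin 8 → Fin 8) : ℤ :=
  ∏ q, ∏ p ∈ Finset.Iio q, Int.sign ((f q : ℤ) - f p)

theorem det_basis_comp (f : Fin 8 → Fin 8) :
    (Matrix.of fun p q => e p (f q)).det = (inversionSign f : ℝ) := by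
  by_cases hf : Function.Injective f
  · obtain ⟨σ, rfl⟩ : ∃ σ : Equiv.Perm (Fin 8), ⇑σ = f :=
      ⟨Equiv.ofBijective f (Finite.injective_iff_bijective.mp hf), rfl⟩
    have h : (Matrix.of fun p q => e p (σ q)) = (1 : Matrix (Fin 8) (Fin 8) ℝ).submatrix id σ := by
      ext p q
      simp [e, Pi.single_apply, Matrix.one_apply, eq_comm]
    rw [h, Matrix.det_permute', Matrix.det_one, mul_one, inversionSign,
      Equiv.Perm.sign_eq_prod_prod_Iio]
    simp only [Units.coe_prod, Int.cast_prod]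
    refine Finset.prod_congr rfl fun q _ => Finset.prod_congr rfl fun p hp => ?_
    have hne : σ p ≠ σ q := σ.injective.ne (Finset.mem_Iio.mp hp).ne
    rcases lt_or_gt_of_ne hne with h | h
    · rw [if_pos h, Int.sign_eq_one_of_pos (by simpa using h)]
      rfl
    · rw [if_neg h.not_gt, Int.sign_eq_neg_one_of_neg (by simpa using h)]
      rfl
  · obtain ⟨p, q, hpq, hne⟩ : ∃ p q, f p = f q ∧ p < q := by
      simp only [Function.Injective, not_forall] at hf
      obtain ⟨p, q, h, hne⟩ := hf
      rcases lt_or_gt_of_ne hne with h' | h'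
      exacts [⟨p, q, h, h'⟩, ⟨q, p, h.symm, h'⟩]
    rw [Matrix.det_zero_of_column_eq hne.ne (by simp [hpq]), inversionSign,
      Finset.prod_eq_zero (Finset.mem_univ q)
        (Finset.prod_eq_zero (Finset.mem_Iio.mpr hne) (by simp [hpq]))]
    simp

theorem wedge_Φ₀_Φ₀_basis : wedge Φ₀ Φ₀ e = 14 := by
  rw [Φ₀_eq_sum, wedge_sum_smul]
  simp only [wedge_alternatization_coordForm, det_basis_comp]
  have h : ∑ s, ∑ t, cayleySign s * cayleySign t *
      inversionSign (Fin.append (cayleyIndex s) (cayleyIndex t)) = 14 := by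
    decide +kernel
  exact_mod_cast h

theorem factorial_mul_wedge_self {k : ℕ} (α : Form k) (v : Fin (k + k) → V) :
    ((k.factorial * k.factorial : ℕ) : ℝ) * wedge α α v
      = ∑ σ : Equiv.Perm (Fin k ⊕ Fin k), (Equiv.Perm.sign σ : ℤ) •
          (α (fun r => v (finSumFinEquiv (σ (Sum.inl r))))
            * α (fun r => v (finSumFinEquiv (σ (Sum.inr r))))) := by
  have h := congrArg (LinearMap.mul' ℝ ℝ) (DFunLike.congr_fun
    (MultilinearMap.domCoprod_alternization_eq α α) (v ∘ finSumFinEquiv))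
  rw [MultilinearMap.alternatization_apply, map_sum, AlternatingMap.smul_apply, map_nsmul,
    Fintype.card_fin, nsmul_eq_mul] at h
  refine h.symm.trans (Finset.sum_congr rfl fun σ _ => ?_)
  rw [Units.smul_def, map_zsmul]
  rfl

theorem wedge_self_map_eq {k : ℕ} {α : Form k} {g : V → V} (h : ∀ v, α (g ∘ v) = α v)
    (v : Fin (k + k) → V) : wedge α α (g ∘ v) = wedge α α v := by
  have hk : ((k.factorial * k.factorial : ℕ) : ℝ) ≠ 0 := by positivity
  refine mul_left_cancel₀ hk ?_
  rw [factorial_mul_wedge_self, factorial_mul_wedge_self]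
  refine Finset.sum_congr rfl fun σ _ => ?_
  rw [← h (fun r => v (finSumFinEquiv (σ (Sum.inl r)))),
    ← h (fun r => v (finSumFinEquiv (σ (Sum.inr r))))]
  rfl

theorem alternatingMap_mulVec_single {ι : Type*} [Fintype ι] [DecidableEq ι]
    (f : (ι → ℝ) [⋀^ι]→ₗ[ℝ] ℝ) (g : Matrix ι ι ℝ) :
    f (fun i => g.mulVec (Pi.single i 1)) = f (fun i => Pi.single i 1) * g.det := by
  have h₁ : (fun i => g.mulVec (Pi.single i 1)) = gᵀ := by
    ext i j
    simp
  have h₂ : ⇑(Pi.basisFun ℝ ι) = fun i => Pi.single i 1 := by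
    ext i
    simp
  have h : f (fun i => g.mulVec (Pi.single i 1)) = f (Pi.basisFun ℝ ι)
      • (Pi.basisFun ℝ ι).det (fun i => g.mulVec (Pi.single i 1)) :=
    DFunLike.congr_fun (f.eq_smul_basis_det (Pi.basisFun ℝ ι)) _
  rw [h, Pi.basisFun_det, h₁, h₂, smul_eq_mul, ← Matrix.det_transpose]
  rfl

theorem det_eq_one_of_map_Φ₀ {g : Matrix (Fin 8) (Fin 8) ℝ}
    (h : ∀ v : Fin 4 → V, Φ₀ (g.mulVec ∘ v) = Φ₀ v) : g.det = 1 := by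
  have h₁ := wedge_self_map_eq h e
  have h₂ := wedge_Φ₀_Φ₀_basis
  generalize wedge Φ₀ Φ₀ = f at h₁ h₂
  change Form 8 at f
  have h₀ : f (g.mulVec ∘ e) = f e * g.det := alternatingMap_mulVec_single f g
  have h₃ : f e * g.det = f e := h₀.symm.trans h₁
  rw [show f e = 14 from h₂] at h₃
  linarith

theorem Φ₀_swap_snd (x y z w : V) : Φ₀ ![x, z, y, w] = -Φ₀ ![x, y, z, w] := by
  rw [← AlternatingMap.map_swap Φ₀ _ (show (1 : Fin 4) ≠ 2 by decide)]
  congr 1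
  ext i : 1
  fin_cases i <;> rfl

theorem Φ₀_swap_thd (x y z w : V) : Φ₀ ![x, y, w, z] = -Φ₀ ![x, y, z, w] := by
  rw [← AlternatingMap.map_swap Φ₀ _ (show (2 : Fin 4) ≠ 3 by decide)]
  congr 1
  ext i : 1
  fin_cases i <;> rfl

theorem Φ₀_swap_fst (x y z w : V) : Φ₀ ![y, x, z, w] = -Φ₀ ![x, y, z, w] := by
  rw [← AlternatingMap.map_swap Φ₀ _ (show (0 : Fin 4) ≠ 1 by decide)]
  congr 1
  ext i : 1
  fin_cases i <;> rfl

theorem Φ₀_cycle (x y z w : V) : Φ₀ ![x, z, w, y] = Φ₀ ![x, y, z, w] := by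
  rw [Φ₀_swap_thd, Φ₀_swap_snd, neg_neg]

theorem Φ₀_apply (v : Fin 4 → V) :
    Φ₀ v = ∑ r : Fin 4 → Fin 8, (∏ s, v s (r s)) * Φ₀ (fun s => e (r s)) := by
  have h : v = fun s => ∑ i, v s i • e i := by
    ext s i
    simp [e, Pi.single_apply]
  conv_lhs => rw [h]
  rw [← AlternatingMap.coe_multilinearMap, MultilinearMap.map_sum]
  refine Finset.sum_congr rfl fun r _ => ?_
  rw [MultilinearMap.map_smul_univ, smul_eq_mul]

theorem sum_pi_fin_succ {n : ℕ} (F : (Fin (n + 1) → Fin 8) → ℝ) :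
    ∑ r, F r = ∑ a, ∑ r : Fin n → Fin 8, F (Matrix.vecCons a r) := by
  rw [← (Fin.consEquiv fun _ => Fin 8).sum_comp, Fintype.sum_prod_type]
  rfl

theorem Φ₀_apply_vec (x y z w : V) :
    Φ₀ ![x, y, z, w] = ∑ a, ∑ b, ∑ c, ∑ d, x a * y b * z c * w d * cayleyCoeff a b c d := by
  have h (a b c d : Fin 8) (r : Fin 0 → Fin 8) :
      (fun s => e ((vecCons a (vecCons b (vecCons c (vecCons d r))) : Fin 4 → Fin 8) s))
        = ![e a, e b, e c, e d] := by
    ext s : 1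
    fin_cases s <;> rfl
  rw [Φ₀_apply]
  simp only [sum_pi_fin_succ, h, Φ₀_basis]
  simp [Fin.prod_univ_four]

/-- `Φ₀` as a matrix indexed by pairs of indices. -/
def cayleyMatrix : Matrix (Fin 8 × Fin 8) (Fin 8 × Fin 8) ℝ :=
  Matrix.of fun p q => (cayleyCoeff p.1 p.2 q.1 q.2 : ℝ)

/-- Twice the projection of `ℝ⁸ ⊗ ℝ⁸` onto the skew-symmetric tensors. -/
def skewMatrix : Matrix (Fin 8 × Fin 8) (Fin 8 × Fin 8) ℝ :=
  Matrix.of fun p q => (if p = q then 1 else 0) - (if p = q.swap then 1 else 0)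

theorem kronecker_conj_cayleyMatrix_apply (h : Matrix (Fin 8) (Fin 8) ℝ) (i j k l : Fin 8) :
    ((h ⊗ₖ h) * cayleyMatrix * (h ⊗ₖ h)ᵀ) (i, j) (k, l) = Φ₀ ![h i, h j, h k, h l] := by
  rw [Φ₀_apply_vec]
  rw [Matrix.mul_assoc]
  simp only [Matrix.mul_apply, Fintype.sum_prod_type, cayleyMatrix, Matrix.of_apply,
    Matrix.kroneckerMap_apply, Matrix.transpose_apply, Finset.mul_sum]
  refine Finset.sum_congr rfl fun a _ => Finset.sum_congr rfl fun b _ =>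
    Finset.sum_congr rfl fun c _ => Finset.sum_congr rfl fun d _ => by ring

theorem skewMatrix_mul_apply (M : Matrix (Fin 8 × Fin 8) (Fin 8 × Fin 8) ℝ) (p q) :
    (skewMatrix * M) p q = M p q - M p.swap q := by
  have h (x : Fin 8 × Fin 8) : p = x.swap ↔ p.swap = x := by
    constructor <;> rintro rfl <;> simp
  simp [skewMatrix, Matrix.mul_apply, sub_mul, Finset.sum_sub_distrib, h]

theorem mul_skewMatrix_apply (M : Matrix (Fin 8 × Fin 8) (Fin 8 × Fin 8) ℝ) (p q) :
    (M * skewMatrix) p q = M p q - M p q.swap := by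
  simp [skewMatrix, Matrix.mul_apply, mul_sub, Finset.sum_sub_distrib]

theorem skewMatrix_mul_kronecker (h : Matrix (Fin 8) (Fin 8) ℝ) :
    skewMatrix * (h ⊗ₖ h) = (h ⊗ₖ h) * skewMatrix := by
  ext p q
  rw [skewMatrix_mul_apply, mul_skewMatrix_apply]
  simp [mul_comm]

theorem cayleyMatrix_mul_self :
    cayleyMatrix * cayleyMatrix = (6 : ℝ) • skewMatrix + (4 : ℝ) • cayleyMatrix := by
  ext ⟨i, j⟩ ⟨m, n⟩
  have h := congrArg (Int.cast : ℤ → ℝ) (cayleyCoeff_contract i j m n)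
  push_cast at h
  simpa [Matrix.mul_apply, Fintype.sum_prod_type, cayleyMatrix, skewMatrix] using h

theorem skewMatrix_mul_cayleyMatrix : skewMatrix * cayleyMatrix = (2 : ℝ) • cayleyMatrix := by
  ext ⟨i, j⟩ ⟨k, l⟩
  rw [skewMatrix_mul_apply]
  simp only [cayleyMatrix, Matrix.of_apply, ← Φ₀_basis, Prod.swap, Φ₀_swap_fst (e i) (e j),
    Matrix.smul_apply, smul_eq_mul]
  ring

theorem kronecker_conj_sub {g : Matrix (Fin 8) (Fin 8) ℝ} (hg : IsUnit g.det)
    (h : (g ⊗ₖ g)ᵀ * cayleyMatrix * (g ⊗ₖ g) = cayleyMatrix) :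
    (g ⊗ₖ g) * cayleyMatrix * (g ⊗ₖ g)ᵀ - cayleyMatrix
      = (2 : ℝ) • ((g ⊗ₖ g) * (g ⊗ₖ g)ᵀ * skewMatrix - skewMatrix) := by
  have hc := skewMatrix_mul_kronecker g
  have hc' : skewMatrix * (g ⊗ₖ g)ᵀ = (g ⊗ₖ g)ᵀ * skewMatrix := skewMatrix_mul_kronecker gᵀ
  have hN := cayleyMatrix_mul_self
  have hA := skewMatrix_mul_cayleyMatrix
  have hK : IsUnit (g ⊗ₖ g).det := by
    rw [Matrix.det_kronecker]
    exact (hg.pow _).mul (hg.pow _)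
  have hK' : IsUnit (g ⊗ₖ g)ᵀ := by
    rwa [Matrix.isUnit_transpose, Matrix.isUnit_iff_isUnit_det]
  generalize g ⊗ₖ g = K at *
  generalize cayleyMatrix = N at *
  generalize skewMatrix = A at *
  have h₁ : N * K * (N - (4 : ℝ) • 1) * Kᵀ = (6 : ℝ) • A := by
    apply hK'.mul_left_cancel
    calc Kᵀ * (N * K * (N - (4 : ℝ) • 1) * Kᵀ)
        = (Kᵀ * N * K) * (N - (4 : ℝ) • 1) * Kᵀ := by simp only [Matrix.mul_assoc]
      _ = ((6 : ℝ) • A) * Kᵀ := by rw [h, Matrix.mul_sub, hN]; simp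
      _ = _ := by rw [Matrix.smul_mul, hc', Matrix.mul_smul]
  have h₂ : (N - (4 : ℝ) • 1) * N = (6 : ℝ) • A := by rw [Matrix.sub_mul, hN]; simp
  have h₃ : ((6 : ℝ) • A) * K * (N - (4 : ℝ) • 1) * Kᵀ = (6 : ℝ) • ((N - (4 : ℝ) • 1) * A) := by
    calc ((6 : ℝ) • A) * K * (N - (4 : ℝ) • 1) * Kᵀ
        = (N - (4 : ℝ) • 1) * (N * K * (N - (4 : ℝ) • 1) * Kᵀ) := by
          rw [← h₂]
          simp only [Matrix.mul_assoc]
      _ = _ := by rw [h₁, Matrix.mul_smul]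
  have h₄ : K * (A * (N - (4 : ℝ) • 1)) * Kᵀ = (N - (4 : ℝ) • 1) * A := by
    have := smul_right_injective _ (show (6 : ℝ) ≠ 0 by norm_num)
      (show (6 : ℝ) • (A * K * (N - (4 : ℝ) • 1) * Kᵀ) = _ by simpa only [Matrix.smul_mul] using h₃)
    rw [hc] at this
    simpa only [Matrix.mul_assoc] using this
  have hA' : N * A = (2 : ℝ) • N := by
    have : (6 : ℝ) • (A * N) = (6 : ℝ) • (N * A) := by
      rw [← Matrix.smul_mul, ← Matrix.mul_smul, ← h₂]
      simp [Matrix.sub_mul, Matrix.mul_sub, Matrix.mul_assoc]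
    rw [← hA]
    exact (smul_right_injective _ (show (6 : ℝ) ≠ 0 by norm_num) this).symm
  rw [Matrix.mul_sub, Matrix.sub_mul, hA, hA', Matrix.mul_sub, Matrix.sub_mul] at h₄
  simp only [Matrix.mul_smul, Matrix.smul_mul, Matrix.mul_one, Matrix.one_mul] at h₄
  rw [Matrix.mul_assoc K A, hc', ← Matrix.mul_assoc] at h₄
  have h₅ : (2 : ℝ) • (K * N * Kᵀ - N) = (2 : ℝ) • ((2 : ℝ) • (K * Kᵀ * A - A)) := by
    rw [← sub_eq_zero] at h₄ ⊢
    rw [← h₄]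
    module
  exact smul_right_injective _ (show (2 : ℝ) ≠ 0 by norm_num) h₅

theorem minors_mul_transpose {g : Matrix (Fin 8) (Fin 8) ℝ} (hg : IsUnit g.det)
    (h : (g ⊗ₖ g)ᵀ * cayleyMatrix * (g ⊗ₖ g) = cayleyMatrix) (i j k l : Fin 8) :
    (g * gᵀ) i k * (g * gᵀ) j l - (g * gᵀ) i l * (g * gᵀ) j k
      = (1 : Matrix (Fin 8) (Fin 8) ℝ) i k * (1 : Matrix (Fin 8) (Fin 8) ℝ) j l
        - (1 : Matrix (Fin 8) (Fin 8) ℝ) i l * (1 : Matrix (Fin 8) (Fin 8) ℝ) j k := by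
  have key (i j k l : Fin 8) : Φ₀ ![g i, g j, g k, g l] - Φ₀ ![e i, e j, e k, e l]
      = 2 * (((g * gᵀ) i k * (g * gᵀ) j l - (g * gᵀ) i l * (g * gᵀ) j k)
        - ((1 : Matrix (Fin 8) (Fin 8) ℝ) i k * (1 : Matrix (Fin 8) (Fin 8) ℝ) j l
        - (1 : Matrix (Fin 8) (Fin 8) ℝ) i l * (1 : Matrix (Fin 8) (Fin 8) ℝ) j k)) := by
    have h₁ := congrFun₂ (kronecker_conj_sub hg h) (i, j) (k, l)
    have hT : (g ⊗ₖ g) * (g ⊗ₖ g)ᵀ = (g * gᵀ) ⊗ₖ (g * gᵀ) := by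
      rw [Matrix.mul_kronecker_mul]; rfl
    rw [Matrix.sub_apply, kronecker_conj_cayleyMatrix_apply, hT, Matrix.smul_apply,
      Matrix.sub_apply, mul_skewMatrix_apply] at h₁
    rw [Φ₀_basis]
    refine h₁.trans ?_
    simp [skewMatrix, Matrix.one_apply, ← ite_and, and_comm]
  have hP (a b : Fin 8) : (g * gᵀ) a b = (g * gᵀ) b a := by
    simp [Matrix.mul_apply, mul_comm]
  have hI (a b : Fin 8) :
      (1 : Matrix (Fin 8) (Fin 8) ℝ) a b = (1 : Matrix (Fin 8) (Fin 8) ℝ) b a := by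
    simp [Matrix.one_apply, eq_comm]
  have h₁ := key i j k l
  have h₂ := key i k l j
  have h₃ := key i l j k
  rw [Φ₀_cycle, Φ₀_cycle (e i)] at h₂
  rw [← Φ₀_cycle, ← Φ₀_cycle (e i)] at h₃
  rw [hP k j, hP k l, hI k j, hI k l] at *
  rw [hP l j, hI l j] at *
  linarith

theorem eq_one_of_minors {P : Matrix (Fin 8) (Fin 8) ℝ} (hu : IsUnit P.det)
    (hnn : ∀ i, 0 ≤ P i i)
    (h : ∀ i j k l, P i k * P j l - P i l * P j k
      = (1 : Matrix (Fin 8) (Fin 8) ℝ) i k * (1 : Matrix (Fin 8) (Fin 8) ℝ) j l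
        - (1 : Matrix (Fin 8) (Fin 8) ℝ) i l * (1 : Matrix (Fin 8) (Fin 8) ℝ) j k) : P = 1 := by
  have hQ : P * P⁻¹ = 1 := Matrix.mul_nonsing_inv P hu
  have h₁ (i j l m : Fin 8) : (P * P⁻¹) i m * P j l - P i l * (P * P⁻¹) j m
      = ((1 : Matrix (Fin 8) (Fin 8) ℝ) * P⁻¹) i m * (1 : Matrix (Fin 8) (Fin 8) ℝ) j l
        - (1 : Matrix (Fin 8) (Fin 8) ℝ) i l * ((1 : Matrix (Fin 8) (Fin 8) ℝ) * P⁻¹) j m := by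
    rw [Matrix.mul_apply, Matrix.mul_apply, Matrix.mul_apply, Matrix.mul_apply]
    simp only [Finset.sum_mul, Finset.mul_sum, ← Finset.sum_sub_distrib]
    refine Finset.sum_congr rfl fun k _ => ?_
    linear_combination P⁻¹ k m * h i j k l
  simp only [hQ, Matrix.one_mul] at h₁
  have hoff (j l : Fin 8) (hjl : j ≠ l) : P j l = 0 := by
    obtain ⟨i, hij, hil⟩ : ∃ i, i ≠ j ∧ i ≠ l := by
      revert j l; decide
    simpa [Matrix.one_apply, hij, hil, hjl, hij.symm] using h₁ i j l i
  have hdiag (i j : Fin 8) (hij : i ≠ j) : P j j = P⁻¹ i i := by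
    simpa [Matrix.one_apply, hij, hij.symm] using h₁ i j j i
  ext j l
  by_cases hjl : j = l
  · subst hjl
    obtain ⟨k, i, hkj, hij, hik⟩ : ∃ k i : Fin 8, k ≠ j ∧ i ≠ j ∧ i ≠ k := by
      revert j; decide
    have h₂ : P k k = P j j := (hdiag i k hik).trans (hdiag i j hij).symm
    have h₃ : P j j * P k k = 1 := by
      simpa [Matrix.one_apply, hkj, hkj.symm, hoff j k hkj.symm] using h j k j k
    rw [h₂] at h₃
    rw [Matrix.one_apply_eq]
    nlinarith [hnn j]
  · rw [hoff j l hjl, Matrix.one_apply_ne hjl]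

theorem transpose_kronecker_conj_cayleyMatrix {g : Matrix (Fin 8) (Fin 8) ℝ}
    (h : ∀ x y z w : V,
      Φ₀ ![g.mulVec x, g.mulVec y, g.mulVec z, g.mulVec w] = Φ₀ ![x, y, z, w]) :
    (g ⊗ₖ g)ᵀ * cayleyMatrix * (g ⊗ₖ g) = cayleyMatrix := by
  have he (i : Fin 8) : gᵀ i = g.mulVec (e i) := by
    ext j
    simp [e]
  ext ⟨i, j⟩ ⟨k, l⟩
  refine (kronecker_conj_cayleyMatrix_apply gᵀ i j k l).trans ?_
  rw [he, he, he, he, h, Φ₀_basis]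
  rfl

/-- **`Spin(7) ⊆ SO(8)`:** if `g ∈ GL(8,ℝ)` satisfies
`Φ₀(gx, gy, gz, gw) = Φ₀(x, y, z, w)` for all `x, y, z, w ∈ ℝ⁸`, then `g` is orthogonal
(`gᵀ g = 1`) and `det g = 1`. -/
theorem spin7_subset_SO8 (g : Matrix (Fin 8) (Fin 8) ℝ) (hg : IsUnit g.det)
    (hfix : ∀ x y z w : V,
      Φ₀ ![g.mulVec x, g.mulVec y, g.mulVec z, g.mulVec w] = Φ₀ ![x, y, z, w]) :
    g.transpose * g = 1 ∧ g.det = 1 := by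
  have hmap (v : Fin 4 → V) : Φ₀ (g.mulVec ∘ v) = Φ₀ v := by
    have h₁ : v = ![v 0, v 1, v 2, v 3] := by
      ext r : 1
      fin_cases r <;> rfl
    have h₂ : g.mulVec ∘ v
        = ![g.mulVec (v 0), g.mulVec (v 1), g.mulVec (v 2), g.mulVec (v 3)] := by
      ext r : 1
      fin_cases r <;> rfl
    rw [h₂, hfix, ← h₁]
  refine ⟨?_, det_eq_one_of_map_Φ₀ hmap⟩
  have hu : IsUnit (g * gᵀ).det := by
    rw [Matrix.det_mul, Matrix.det_transpose]
    exact hg.mul hg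
  have hnn (i : Fin 8) : 0 ≤ (g * gᵀ) i i := by
    rw [Matrix.mul_apply]
    exact Finset.sum_nonneg fun j _ => mul_self_nonneg (g i j)
  exact mul_eq_one_comm.mp (eq_one_of_minors hu hnn
    (minors_mul_transpose hg (transpose_kronecker_conj_cayleyMatrix hfix)))

end
end

section
/- The operator M is self-adjoint with respect to ⟨·,·⟩ and satisfies M∘M = 2·M + 3·id, i.e. (M − 3·id)∘(M + id) = 0, so the only possible eigenvalues of M are 3 and −1. -/
open scoped TensorProduct
open Matrix

noncomputable section

/-- The elementary form `e^{f₁}∧e^{f₂}∧⋯` (determinant convention). -/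
def elementaryForm {ι : Type*} [Fintype ι] [DecidableEq ι] (f : ι → Fin 8) :
    V [⋀^ι]→ₗ[ℝ] ℝ :=
  (Matrix.detRowAlternating : (ι → ℝ) [⋀^ι]→ₗ[ℝ] ℝ).compLinearMap (LinearMap.funLeft ℝ ℝ f)

section elementaryForm

variable {ι κ : Type*} [Fintype ι] [DecidableEq ι] [Fintype κ] [DecidableEq κ]

theorem detRowAlternating_apply (v : ι → ι → ℝ) :
    (Matrix.detRowAlternating : (ι → ℝ) [⋀^ι]→ₗ[ℝ] ℝ) v = (Matrix.of v).det := rfl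

theorem elementaryForm_apply (f : ι → Fin 8) (v : ι → V) :
    elementaryForm f v = Matrix.det (Matrix.of fun a b => v a (f b)) := rfl

theorem elementaryForm_eq_alternatization (f : ι → Fin 8) :
    elementaryForm f = MultilinearMap.alternatization
      ((MultilinearMap.mkPiAlgebra ℝ ι ℝ).compLinearMap
        fun b => (LinearMap.proj (f b) : V →ₗ[ℝ] ℝ)) := by
  ext v
  simp [elementaryForm_apply, Matrix.det_apply, MultilinearMap.alternatization_apply]

theorem elementaryForm_domCoprod (f : ι → Fin 8) (g : κ → Fin 8) :
    (LinearMap.mul' ℝ ℝ).compAlternatingMap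
      ((elementaryForm f).domCoprod (elementaryForm g)) = elementaryForm (Sum.elim f g) := by
  simp_rw [elementaryForm_eq_alternatization]
  rw [← MultilinearMap.domCoprod_alternization, ← LinearMap.compMultilinearMap_alternatization]
  congr 1
  ext v
  simp [MultilinearMap.domCoprod_apply, Fintype.prod_sum_type]

end elementaryForm

theorem wedge_elementaryForm {k l : ℕ} (f : Fin k → Fin 8) (g : Fin l → Fin 8) :
    wedge (elementaryForm f) (elementaryForm g) = elementaryForm (Fin.append f g) := by
  rw [wedge, elementaryForm_domCoprod]
  ext v
  rw [AlternatingMap.domDomCongr_apply, elementaryForm_apply, elementaryForm_apply,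
    ← Matrix.det_submatrix_equiv_self finSumFinEquiv]
  congr 1
  ext a (b | b) <;> simp

theorem form_add_apply {k : ℕ} (α β : Form k) (v : Fin k → V) : (α + β) v = α v + β v := rfl

theorem form_sub_apply {k : ℕ} (α β : Form k) (v : Fin k → V) : (α - β) v = α v - β v := rfl

theorem wedge_add_right {k l : ℕ} (α : Form k) (β γ : Form l) :
    wedge α (β + γ) = wedge α β + wedge α γ := by
  ext v
  simp only [wedge, ← AlternatingMap.domCoprod'_apply, TensorProduct.tmul_add, map_add]
  simp

theorem wedge_sub_right {k l : ℕ} (α : Form k) (β γ : Form l) :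
    wedge α (β - γ) = wedge α β - wedge α γ := by
  rw [eq_sub_iff_add_eq, ← wedge_add_right, sub_add_cancel]

/-- The sign of the comparison of `a` and `b`: `1` if `a < b`, `-1` if `b < a`, else `0`. -/
def pairSign (a b : Fin 8) : ℤ := if a < b then 1 else if b < a then -1 else 0

/-- The sign of the permutation sorting a list of indices, or `0` if an index is repeated. -/
def sortSign : List (Fin 8) → ℤ
  | [] => 1
  | a :: l => if a ∈ l then 0 else (l.map (pairSign a)).prod * sortSign l

theorem sortSign_cons (a : Fin 8) (l : List (Fin 8)) :
    sortSign (a :: l) = (l.map (pairSign a)).prod * sortSign l := by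
  rw [sortSign]
  split_ifs with h
  · rw [List.prod_eq_zero (List.mem_map.2 ⟨a, h, by simp [pairSign]⟩), zero_mul]
  · rfl

theorem sortSign_ofFn {n : ℕ} (f : Fin n → Fin 8) :
    sortSign (List.ofFn f) = ∏ i, ∏ j ∈ Finset.Ioi i, pairSign (f i) (f j) := by
  induction n with
  | zero => simp [sortSign]
  | succ n ih =>
    simp only [List.ofFn_succ, sortSign_cons, ih, Fin.prod_univ_succ, Fin.prod_Ioi_zero,
      Fin.prod_Ioi_succ, List.map_ofFn, List.prod_ofFn, Function.comp_apply]

theorem elementaryForm_basis (f : Fin 8 → Fin 8) :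
    elementaryForm f e = (sortSign (List.ofFn f) : ℝ) := by
  have hdet : elementaryForm f e = ((1 : Matrix (Fin 8) (Fin 8) ℝ).submatrix id f).det := by
    rw [elementaryForm_apply]
    congr 1
    ext a b
    simp [e, Matrix.one_apply, Pi.single_apply, eq_comm]
  rw [hdet, sortSign_ofFn]
  by_cases hf : Function.Injective f
  · obtain ⟨σ, rfl⟩ : ∃ σ : Equiv.Perm (Fin 8), ⇑σ = f :=
      ⟨Equiv.ofBijective f (Finite.injective_iff_bijective.1 hf), rfl⟩
    rw [Matrix.det_permute', Matrix.det_one, mul_one, σ.sign_eq_prod_prod_Ioi]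
    push_cast
    refine Finset.prod_congr rfl fun i _ => Finset.prod_congr rfl fun j hj => ?_
    have hne : σ i ≠ σ j := σ.injective.ne (Finset.mem_Ioi.1 hj).ne
    rcases hne.lt_or_gt with h | h
    · simp [pairSign, h]
    · simp [pairSign, h, h.not_gt]
  · obtain ⟨i, j, hij, hlt⟩ : ∃ i j, f i = f j ∧ i < j := by
      simp only [Function.Injective, not_forall] at hf
      obtain ⟨i, j, hij, hne⟩ := hf
      rcases lt_or_gt_of_ne hne with h | h
      exacts [⟨i, j, hij, h⟩, ⟨j, i, hij.symm, h⟩]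
    have hcol : ∀ a, (1 : Matrix (Fin 8) (Fin 8) ℝ).submatrix id f a i =
        (1 : Matrix (Fin 8) (Fin 8) ℝ).submatrix id f a j := fun a => by
      rw [Matrix.submatrix_apply, Matrix.submatrix_apply, hij]
    rw [Matrix.det_zero_of_column_eq hlt.ne hcol,
      Finset.prod_eq_zero (Finset.mem_univ i) (Finset.prod_eq_zero (Finset.mem_Ioi.2 hlt)
        (by simp [pairSign, hij])), Int.cast_zero]

/-- The coefficient of `eⁱ∧eʲ∧eᵏ∧eˡ∧Φ₀` with respect to `vol₀`. -/
def dualCayleyCoeff (i j k l : Fin 8) : ℤ :=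
  sortSign [i, j, k, l, 0, 1, 2, 3] + sortSign [i, j, k, l, 0, 1, 4, 5]
    + sortSign [i, j, k, l, 0, 1, 6, 7] + sortSign [i, j, k, l, 0, 2, 4, 6]
    - sortSign [i, j, k, l, 0, 2, 5, 7] - sortSign [i, j, k, l, 0, 3, 4, 7]
    - sortSign [i, j, k, l, 0, 3, 5, 6] + sortSign [i, j, k, l, 4, 5, 6, 7]
    + sortSign [i, j, k, l, 2, 3, 6, 7] + sortSign [i, j, k, l, 2, 3, 4, 5]
    + sortSign [i, j, k, l, 1, 3, 5, 7] - sortSign [i, j, k, l, 1, 3, 4, 6]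
    - sortSign [i, j, k, l, 1, 2, 5, 6] - sortSign [i, j, k, l, 1, 2, 4, 7]

theorem wedge_wedge_E4_basis (i j k l a b c d : Fin 8) :
    wedge (wedge (elementaryForm ![i, j]) (elementaryForm ![k, l])) (E4 a b c d) e =
      (sortSign [i, j, k, l, a, b, c, d] : ℝ) := by
  rw [show E4 a b c d = elementaryForm ![a, b, c, d] from rfl, wedge_elementaryForm,
    wedge_elementaryForm]
  have hlist : List.ofFn (Fin.append (Fin.append ![i, j] ![k, l]) ![a, b, c, d]) =
      [i, j, k, l, a, b, c, d] := by
    rw [List.ofFn_fin_append, List.ofFn_fin_append]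
    simp
  rw [← hlist]
  rw [elementaryForm_basis (Fin.append (Fin.append ![i, j] ![k, l]) ![a, b, c, d])]

theorem wedge_wedge_cayley_basis (i j k l : Fin 8) :
    wedge (wedge (elementaryForm ![i, j]) (elementaryForm ![k, l])) Φ₀ e =
      (dualCayleyCoeff i j k l : ℝ) := by
  simp only [Φ₀, wedge_add_right, wedge_sub_right]
  simp only [form_add_apply, form_sub_apply, wedge_wedge_E4_basis, dualCayleyCoeff, Int.cast_add,
    Int.cast_sub]

theorem vol₀_basis : vol₀ e = 1 := by
  have he : Matrix.of e = (1 : Matrix (Fin 8) (Fin 8) ℝ) := by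
    ext a b
    simp [e, Matrix.one_apply, Pi.single_apply, eq_comm]
  rw [vol₀, detRowAlternating_apply, he, Matrix.det_one]

theorem formInner_comm {k : ℕ} (α β : Form k) : formInner α β = formInner β α := by
  simp only [formInner, mul_comm]

theorem formInner_add_left {k : ℕ} (α β γ : Form k) :
    formInner (α + β) γ = formInner α γ + formInner β γ := by
  rw [formInner, formInner, formInner, ← Finset.sum_add_distrib]
  refine Finset.sum_congr rfl fun s _ => ?_
  split_ifs
  · simp [add_mul]
  · simp

theorem formInner_smul_left {k : ℕ} (c : ℝ) (α β : Form k) :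
    formInner (c • α) β = c * formInner α β := by
  rw [formInner, formInner, Finset.mul_sum]
  refine Finset.sum_congr rfl fun s _ => ?_
  split_ifs
  · simp [mul_assoc]
  · simp

/-- `formInner` as a bilinear form. -/
def formInnerBilin (k : ℕ) : LinearMap.BilinForm ℝ (Form k) :=
  LinearMap.mk₂ ℝ formInner formInner_add_left formInner_smul_left
    (fun α β γ => by simp only [formInner_comm α, formInner_add_left])
    (fun c α β => by simp only [formInner_comm α, formInner_smul_left, smul_eq_mul])

@[simp]
theorem formInnerBilin_apply {k : ℕ} (α β : Form k) :
    formInnerBilin k α β = formInner α β := rfl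

/-- The value of `eⁱ∧eʲ` on `(e_k, e_l)`. -/
def pairDelta (i j k l : Fin 8) : ℤ :=
  (if i = k ∧ j = l then 1 else 0) - if i = l ∧ j = k then 1 else 0

theorem elementaryForm_pair_basis (i j k l : Fin 8) :
    elementaryForm ![i, j] ![e k, e l] = (pairDelta i j k l : ℝ) := by
  rw [elementaryForm_apply, Matrix.det_fin_two]
  simp only [e, Matrix.of_apply, Matrix.cons_val_zero, Matrix.cons_val_one, Pi.single_apply,
    pairDelta, ite_and]
  push_cast
  split_ifs <;> simp

theorem elementaryForm_swap (i j : Fin 8) :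
    elementaryForm ![j, i] = -elementaryForm ![i, j] := by
  ext v
  simp only [AlternatingMap.neg_apply, elementaryForm_apply, Matrix.det_fin_two, Matrix.of_apply,
    Matrix.cons_val_zero, Matrix.cons_val_one]
  ring

theorem elementaryForm_self (i : Fin 8) : elementaryForm ![i, i] = 0 := by
  ext v
  simp [elementaryForm_apply, Matrix.det_fin_two]

theorem form_two_swap (α : Form 2) (x y : V) : α ![y, x] = -α ![x, y] := by
  rw [← α.map_swap ![x, y] (zero_ne_one (α := Fin 2))]
  congr 1
  ext a
  fin_cases a <;> simp

theorem form_two_self (α : Form 2) (x : V) : α ![x, x] = 0 :=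
  α.map_eq_zero_of_eq ![x, x] (i := 0) (j := 1) rfl zero_ne_one

theorem form_two_ext {α β : Form 2} (h : ∀ i j, i < j → α ![e i, e j] = β ![e i, e j]) :
    α = β := by
  have hall : ∀ i j, α ![e i, e j] = β ![e i, e j] := fun i j => by
    rcases lt_trichotomy i j with hij | rfl | hij
    · exact h i j hij
    · simp only [form_two_self]
    · rw [form_two_swap α (e j), form_two_swap β (e j), h j i hij]
  refine (Pi.basisFun ℝ (Fin 8)).ext_alternating fun v _ => ?_
  convert hall (v 0) (v 1) using 2 <;>
  · ext a : 1
    fin_cases a <;> simp [e]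

theorem form_sum_apply {k : ℕ} {ι : Type*} (s : Finset ι) (ω : ι → Form k) (v : Fin k → V) :
    (∑ i ∈ s, ω i) v = ∑ i ∈ s, ω i v :=
  map_sum (AddMonoidHom.mk' (fun α : Form k => α v) fun _ _ => rfl) ω s

theorem form_two_eq_sum (α : Form 2) :
    α = (2⁻¹ : ℝ) • ∑ i, ∑ j, α ![e i, e j] • elementaryForm ![i, j] := by
  refine form_two_ext fun k l _ => ?_
  simp only [AlternatingMap.smul_apply, form_sum_apply, elementaryForm_pair_basis, pairDelta,
    smul_eq_mul]
  push_cast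
  simp only [mul_sub, Finset.sum_sub_distrib, mul_ite, mul_one, mul_zero, ite_and]
  simp [form_two_swap α (e k) (e l)]
  ring

theorem linearMap_form_two_ext {W : Type*} [AddCommGroup W] [Module ℝ W] {S T : Form 2 →ₗ[ℝ] W}
    (h : ∀ i j, i < j → S (elementaryForm ![i, j]) = T (elementaryForm ![i, j])) : S = T := by
  have hall : ∀ i j, S (elementaryForm ![i, j]) = T (elementaryForm ![i, j]) := fun i j => by
    rcases lt_trichotomy i j with hij | rfl | hij
    · exact h i j hij
    · simp only [elementaryForm_self, map_zero]
    · rw [elementaryForm_swap j i, map_neg, map_neg, h j i hij]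
  refine LinearMap.ext fun α => ?_
  rw [form_two_eq_sum α]
  simp only [map_smul, map_sum, hall]

theorem formInner_elementaryForm_of_lt (α : Form 2) {k l : Fin 8} (hkl : k < l) :
    formInner α (elementaryForm ![k, l]) = α ![e k, e l] := by
  have hcard : ({k, l} : Finset (Fin 8)).card = 2 := Finset.card_pair hkl.ne
  have hmono : StrictMono ![k, l] := by
    intro a b hab
    fin_cases a <;> fin_cases b <;> simp_all
  have hord := Finset.orderEmbOfFin_unique hcard (f := ![k, l])
    (fun x => by fin_cases x <;> simp) hmono
  rw [formInner, Finset.sum_eq_single {k, l}]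
  · have hbasis : (fun a => e ((({k, l} : Finset (Fin 8)).orderIsoOfFin hcard a : Fin 8))) =
        ![e k, e l] := by
      ext1 a
      rw [Finset.coe_orderIsoOfFin_apply, ← hord]
      fin_cases a <;> rfl
    rw [dif_pos hcard, hbasis, elementaryForm_pair_basis]
    simp [pairDelta, hkl.ne]
  · intro s _ hs
    split_ifs with h
    · refine mul_eq_zero_of_right _ ?_
      set a := (s.orderIsoOfFin h 0 : Fin 8) with ha
      set b := (s.orderIsoOfFin h 1 : Fin 8) with hb
      have hab : a < b := (s.orderIsoOfFin h).strictMono zero_lt_one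
      have hbasis : (fun c => e ((s.orderIsoOfFin h c : Fin 8))) = ![e a, e b] := by
        ext1 c
        fin_cases c <;> rfl
      have hsab : s = {a, b} := by
        refine (Finset.eq_of_subset_of_card_le ?_ ?_).symm
        · simp [Finset.insert_subset_iff, a, b]
        · rw [h, Finset.card_pair hab.ne]
      rw [hbasis, elementaryForm_pair_basis, pairDelta, if_neg, if_neg]
      · simp
      · rintro ⟨rfl, rfl⟩
        exact hkl.not_gt hab
      · rintro ⟨rfl, rfl⟩
        exact hs hsab
    · rfl
  · simp

theorem formInner_elementaryForm (α : Form 2) (k l : Fin 8) :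
    formInner α (elementaryForm ![k, l]) = α ![e k, e l] := by
  rcases lt_trichotomy k l with h | rfl | h
  · exact formInner_elementaryForm_of_lt α h
  · rw [elementaryForm_self, form_two_self, ← formInnerBilin_apply, map_zero]
  · rw [elementaryForm_swap, form_two_swap, ← formInnerBilin_apply, map_neg,
      formInnerBilin_apply, formInner_elementaryForm_of_lt α h]

/-- For each `d`, index pairs `(i, j)` such that the forms `eⁱ∧eʲ` sum to an element of `Ω²₇`. -/
def omegaSevenPair : Fin 7 → Fin 4 → Fin 8 × Fin 8 :=
  ![![(0, 1), (2, 3), (4, 5), (6, 7)],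
    ![(0, 2), (3, 1), (4, 6), (7, 5)],
    ![(0, 3), (1, 2), (7, 4), (6, 5)],
    ![(0, 4), (5, 1), (6, 2), (3, 7)],
    ![(0, 5), (1, 4), (2, 7), (3, 6)],
    ![(0, 6), (7, 1), (2, 4), (5, 3)],
    ![(0, 7), (1, 6), (5, 2), (4, 3)]]

theorem dualCayleyCoeff_eq (i j k l : Fin 8) (hij : i < j) (hkl : k < l) :
    dualCayleyCoeff i j k l =
      ∑ d, (∑ r, pairDelta (omegaSevenPair d r).1 (omegaSevenPair d r).2 i j) *
        (∑ r, pairDelta (omegaSevenPair d r).1 (omegaSevenPair d r).2 k l) - pairDelta i j k l := by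
  simp only [Fin.sum_univ_succ, Fin.sum_univ_zero]
  revert i j k l
  decide +kernel

theorem omegaSevenPair_orthogonal (c d : Fin 7) :
    ∑ r, ∑ s, pairDelta (omegaSevenPair c r).1 (omegaSevenPair c r).2 (omegaSevenPair d s).1
      (omegaSevenPair d s).2 = if c = d then 4 else 0 := by
  revert c d
  decide +kernel

/-- An orthogonal basis of `Ω²₇`. -/
def omegaSevenForm (d : Fin 7) : Form 2 :=
  ∑ r, elementaryForm ![(omegaSevenPair d r).1, (omegaSevenPair d r).2]

theorem omegaSevenForm_basis (d : Fin 7) (k l : Fin 8) :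
    omegaSevenForm d ![e k, e l] =
      ((∑ r, pairDelta (omegaSevenPair d r).1 (omegaSevenPair d r).2 k l : ℤ) : ℝ) := by
  simp only [omegaSevenForm, form_sum_apply, elementaryForm_pair_basis]
  push_cast
  rfl

theorem formInner_omegaSevenForm (c d : Fin 7) :
    formInner (omegaSevenForm c) (omegaSevenForm d) = if c = d then 4 else 0 := by
  rw [omegaSevenForm.eq_def d, ← formInnerBilin_apply, map_sum]
  simp only [formInnerBilin_apply, formInner_elementaryForm, omegaSevenForm_basis]
  rw [← Int.cast_sum, Finset.sum_comm, omegaSevenPair_orthogonal]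
  push_cast
  rfl

theorem hodge_operator_eq {M : Form 2 →ₗ[ℝ] Form 2}
    (hM : ∀ α β : Form 2, wedge (wedge α β) Φ₀ = formInner (M α) β • vol₀) (α : Form 2) :
    M α = ∑ d, formInner α (omegaSevenForm d) • omegaSevenForm d - α := by
  suffices h : M = ∑ d, (formInnerBilin 2 (omegaSevenForm d)).smulRight (omegaSevenForm d)
      - LinearMap.id by
    rw [h]
    simp [formInner_comm α]
  refine linearMap_form_two_ext fun i j hij => form_two_ext fun k l hkl => ?_
  have hcoeff := congrArg (fun ω : Form 8 => ω e) (hM (elementaryForm ![i, j])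
    (elementaryForm ![k, l]))
  simp only [AlternatingMap.smul_apply, vol₀_basis, smul_eq_mul, mul_one,
    formInner_elementaryForm] at hcoeff
  rw [← hcoeff, wedge_wedge_cayley_basis, dualCayleyCoeff_eq i j k l hij hkl]
  simp only [LinearMap.sub_apply, LinearMap.sum_apply, LinearMap.smulRight_apply,
    formInnerBilin_apply, LinearMap.id_apply, AlternatingMap.sub_apply,
    form_sum_apply, AlternatingMap.smul_apply, smul_eq_mul, omegaSevenForm_basis,
    elementaryForm_pair_basis, formInner_elementaryForm]
  push_cast
  rfl

theorem hodge_operator_omegaSevenForm {M : Form 2 →ₗ[ℝ] Form 2}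
    (hM : ∀ α β : Form 2, wedge (wedge α β) Φ₀ = formInner (M α) β • vol₀) (d : Fin 7) :
    M (omegaSevenForm d) = (3 : ℝ) • omegaSevenForm d := by
  rw [hodge_operator_eq hM]
  simp only [formInner_omegaSevenForm, ite_smul, zero_smul, Finset.sum_ite_eq, Finset.mem_univ,
    if_true]
  module

/-- **The operator `M` (i.e. `α ↦ *(Φ₀∧α)`) is self-adjoint and satisfies
`M∘M = 2·M + 3·id`,** i.e. `(M − 3·id)∘(M + id) = 0`, so the only possible eigenvalues
of `M` are `3` and `−1`. Here `M` is the unique endomorphism of the alternating 2-forms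
on `ℝ⁸` such that `α∧β∧Φ₀ = ⟨Mα, β⟩·vol₀` for all 2-forms `α, β`. -/
theorem hodge_operator_quadratic (M : Form 2 →ₗ[ℝ] Form 2)
    (hM : ∀ α β : Form 2, wedge (wedge α β) Φ₀ = formInner (M α) β • vol₀) :
    (∀ α β : Form 2, formInner (M α) β = formInner α (M β)) ∧
    (M ∘ₗ M = (2 : ℝ) • M + (3 : ℝ) • LinearMap.id) ∧
    ((M - (3 : ℝ) • LinearMap.id) ∘ₗ (M + LinearMap.id) = 0) ∧
    (∀ c : ℝ, ∀ α : Form 2, α ≠ 0 → M α = c • α → c = 3 ∨ c = -1) := by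
  have hsq : M ∘ₗ M = (2 : ℝ) • M + (3 : ℝ) • LinearMap.id := by
    ext1 α
    have hα := hodge_operator_eq hM α
    have hMα : M (M α) = (3 : ℝ) • (M α + α) - M α := by
      conv_lhs => rw [hα]
      rw [map_sub, map_sum, hα]
      simp only [map_smul, hodge_operator_omegaSevenForm hM, Finset.smul_sum, sub_add_cancel,
        smul_comm (3 : ℝ)]
    simp only [LinearMap.comp_apply, LinearMap.add_apply, LinearMap.smul_apply, LinearMap.id_apply,
      hMα]
    module
  have hprod : (M - (3 : ℝ) • LinearMap.id) ∘ₗ (M + LinearMap.id) = 0 := by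
    rw [LinearMap.sub_comp, LinearMap.comp_add, hsq, LinearMap.smul_comp, LinearMap.id_comp,
      LinearMap.comp_id]
    module
  refine ⟨fun α β => ?_, hsq, hprod, fun c α hα hc => ?_⟩
  · rw [hodge_operator_eq hM α, hodge_operator_eq hM β]
    simp only [← formInnerBilin_apply, map_sub, map_sum, map_smul, LinearMap.sub_apply,
      LinearMap.sum_apply, LinearMap.smul_apply, smul_eq_mul]
    simp only [formInnerBilin_apply, formInner_comm (omegaSevenForm _), mul_comm]
  · have h : ((c - 3) * (c + 1)) • α = 0 := by
      have := LinearMap.congr_fun hprod α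
      simp only [LinearMap.comp_apply, LinearMap.sub_apply, LinearMap.add_apply,
        LinearMap.smul_apply, LinearMap.id_apply, hc, map_add, map_smul,
        LinearMap.zero_apply] at this
      rw [← this]
      module
    rcases mul_eq_zero.1 ((smul_eq_zero.1 h).resolve_right hα) with h | h
    · exact Or.inl (sub_eq_zero.1 h)
    · exact Or.inr (eq_neg_of_add_eq_zero_left h)

end
end
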